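/- Let G be a simple graph, let S be a finite set of its vertices with |S| ≥ 2, and let 0 < γ ≤ 1. If |E[S]| > γ·|S|·(|S|−1)/2, then for every integer i with 2 ≤ i ≤ |S| there exists a subset T ⊆ S with |T| = i such that |E[T]| > γ·i·(i−1)/2. -/

import Mathlib

open Finset

/-- `edgesIn G S` is the set `E[S]` of edges of `G` with both endpoints in `S`. -/
def edgesIn {V : Type*} [Fintype V] [DecidableEq V] (G : SimpleGraph V)
    [DecidableRel G.Adj] (S : Finset V) : Finset (Sym2 V) :=
  G.edgeFinset.filter (· ∈ S.sym2)

theorem edgesIn_erase {V : Type*} [Fintype V] [DecidableEq V] (G : SimpleGraph V)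
    [DecidableRel G.Adj] (S : Finset V) (v : V) :
    edgesIn G (S.erase v) = (edgesIn G S).filter (fun e => v ∉ e) := by
  ext e
  induction e with
  | _ a b =>
    simp only [edgesIn, mem_filter, Finset.mk_mem_sym2_iff, mem_erase, Sym2.mem_iff]
    grind

/-- Double counting: each edge inside `S` survives the deletion of all but two vertices of `S`. -/
theorem sum_card_edgesIn_erase {V : Type*} [Fintype V] [DecidableEq V] (G : SimpleGraph V)
    [DecidableRel G.Adj] (S : Finset V) :
    ∑ v ∈ S, (edgesIn G (S.erase v)).card = (edgesIn G S).card * (S.card - 2) := by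
  simp only [edgesIn_erase]
  rw [← smul_eq_mul, ← sum_const]
  refine (sum_card_bipartiteAbove_eq_sum_card_bipartiteBelow (fun v e => v ∉ e)).trans
    (sum_congr rfl fun e he => ?_)
  induction e with
  | _ a b =>
    simp only [edgesIn, mem_filter, Finset.mk_mem_sym2_iff, SimpleGraph.mem_edgeFinset,
      SimpleGraph.mem_edgeSet] at he
    obtain ⟨hadj, ha, hb⟩ := he
    have h : S.bipartiteBelow (fun v e => v ∉ e) s(a, b) = S \ {a, b} := by
      ext v
      simp [bipartiteBelow]
    rw [h, card_sdiff_of_subset (by simp [insert_subset_iff, ha, hb]), card_pair hadj.ne]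

/-- Some vertex can be deleted from a γ-clique on at least three vertices, leaving a γ-clique. -/
theorem exists_erase_dense {V : Type*} [Fintype V] [DecidableEq V] (G : SimpleGraph V)
    [DecidableRel G.Adj] (S : Finset V) (γ : ℝ) (hS : 3 ≤ S.card)
    (hdense : γ * (S.card : ℝ) * ((S.card : ℝ) - 1) / 2 < ((edgesIn G S).card : ℝ)) :
    ∃ v ∈ S, γ * ((S.card : ℝ) - 1) * ((S.card : ℝ) - 2) / 2 <
      ((edgesIn G (S.erase v)).card : ℝ) := by
  apply exists_lt_of_sum_lt
  have h : ∑ v ∈ S, ((edgesIn G (S.erase v)).card : ℝ) =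
      (edgesIn G S).card * ((S.card : ℝ) - 2) := by
    have := sum_card_edgesIn_erase G S
    rw [← Nat.cast_sum, this, Nat.cast_mul, Nat.cast_sub (by omega), Nat.cast_ofNat]
  rw [h, sum_const, nsmul_eq_mul]
  have h3 : (3 : ℝ) ≤ S.card := by exact_mod_cast hS
  have := mul_lt_mul_of_pos_right hdense (by linarith : (0 : ℝ) < S.card - 2)
  linarith

/-- If `S` is a γ-clique, then for every `2 ≤ i ≤ |S|` some subset of `S` of size `i`
is a γ-clique. -/
theorem stmt0 {V : Type*} [Fintype V] [DecidableEq V] (G : SimpleGraph V)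
    [DecidableRel G.Adj] (S : Finset V) (γ : ℝ) (hγ0 : 0 < γ) (hγ1 : γ ≤ 1)
    (hS : 2 ≤ S.card)
    (hdense : γ * (S.card : ℝ) * ((S.card : ℝ) - 1) / 2 < ((edgesIn G S).card : ℝ)) :
    ∀ i : ℕ, 2 ≤ i → i ≤ S.card →
      ∃ T ⊆ S, T.card = i ∧ γ * (i : ℝ) * ((i : ℝ) - 1) / 2 < ((edgesIn G T).card : ℝ) := by
  intro i hi hiS
  induction hiS using Nat.decreasingInduction with
  | self => exact ⟨S, Subset.rfl, rfl, hdense⟩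
  | of_succ k hk ih =>
    obtain ⟨T, hTS, hT, hd⟩ := ih (by omega)
    obtain ⟨v, hv, hlt⟩ := exists_erase_dense G T γ (by omega) (by rwa [hT])
    refine ⟨T.erase v, (erase_subset v T).trans hTS, by rw [card_erase_of_mem hv, hT]; rfl, ?_⟩
    convert hlt using 1
    rw [hT]
    push_cast
    ring
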